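/- Suppose μ satisfies a logarithmic Sobolev inequality with constant C_{LS}(μ), V is of class C¹, F is of class C², and μ(e^{-F}) = 1. Assume there exist α > 1 and β > 0 such that μ_F(e^{α F}) < ∞, μ_F(e^{β [AF − (1/2)|∇F|²]}) < ∞, and δ := C_{LS}(μ)/(2β) + 1/α < 1, where A = Δ − ∇V·∇. Then μ_F satisfies a logarithmic Sobolev inequality with C_{LS}(μ_F) ≤ (1/(1−δ)) [ C_{LS}(μ) + C_P(μ_F) ( 2 + (C_{LS}(μ)/(2β)) ln μ_F(e^{β [AF − (1/2)|∇F|²]}) + (1/α) ln μ_F(e^{α F}) ) ]. -/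

import Mathlib

open MeasureTheory Real Set
open scoped ENNReal RealInnerProductSpace Pointwise Matrix

noncomputable section

/-- Euclidean space ℝ^n. -/
abbrev En (n : ℕ) := EuclideanSpace ℝ (Fin n)

/-- Test functions: smooth, bounded and Lipschitz. -/
def IsTestFun {n : ℕ} (f : En n → ℝ) : Prop :=
  ContDiff ℝ (⊤ : ℕ∞) f ∧ (∃ M, ∀ x, |f x| ≤ M) ∧ ∃ L, LipschitzWith L f

/-- `μ` satisfies a Poincaré inequality with constant `C`. -/
def PoincareLE {n : ℕ} (μ : Measure (En n)) (C : ℝ) : Prop :=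
  ∀ f : En n → ℝ, IsTestFun f →
    (∫ x, (f x) ^ 2 ∂μ) - (∫ x, f x ∂μ) ^ 2 ≤ C * ∫ x, ‖gradient f x‖ ^ 2 ∂μ

/-- `μ` satisfies a logarithmic Sobolev inequality with constant `C`. -/
def LogSobolevLE {n : ℕ} (μ : Measure (En n)) (C : ℝ) : Prop :=
  ∀ f : En n → ℝ, IsTestFun f →
    (∫ x, (f x) ^ 2 * Real.log ((f x) ^ 2) ∂μ)
        - (∫ x, (f x) ^ 2 ∂μ) * Real.log (∫ x, (f x) ^ 2 ∂μ)
      ≤ C * ∫ x, ‖gradient f x‖ ^ 2 ∂μ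

/-- `μ` satisfies an L¹-Poincaré inequality (around the mean) with constant `C`. -/
def CheegerMeanLE {n : ℕ} (μ : Measure (En n)) (C : ℝ) : Prop :=
  ∀ f : En n → ℝ, IsTestFun f →
    ∫ x, |f x - ∫ y, f y ∂μ| ∂μ ≤ C * ∫ x, ‖gradient f x‖ ∂μ

/-- `m` is a median of `f` under `μ`. -/
def IsMedian {n : ℕ} (μ : Measure (En n)) (f : En n → ℝ) (m : ℝ) : Prop :=
  ENNReal.ofReal (1 / 2) ≤ μ {x | f x ≤ m} ∧ ENNReal.ofReal (1 / 2) ≤ μ {x | m ≤ f x}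

/-- `μ` satisfies a Cheeger inequality (around medians) with constant `C`. -/
def CheegerMedianLE {n : ℕ} (μ : Measure (En n)) (C : ℝ) : Prop :=
  ∀ f : En n → ℝ, IsTestFun f → ∀ m : ℝ, IsMedian μ f m →
    ∫ x, |f x - m| ∂μ ≤ C * ∫ x, ‖gradient f x‖ ∂μ

/-- The perturbed (normalized) measure `μ_F = Z_F⁻¹ e^{-F} μ`. -/
def perturb {n : ℕ} (μ : Measure (En n)) (F : En n → ℝ) : Measure (En n) :=
  (ENNReal.ofReal (∫ x, Real.exp (-F x) ∂μ))⁻¹ •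
    μ.withDensity fun x => ENNReal.ofReal (Real.exp (-F x))

/-- Topological support of a measure. -/
def measSupport {n : ℕ} (μ : Measure (En n)) : Set (En n) :=
  {x | ∀ U ∈ nhds x, 0 < μ U}

/-- `μ` is log-concave: it has density `e^{-W}` on a convex set, with `W` convex
(equivalently, density `e^{-W}` with `W : ℝⁿ → ℝ ∪ {+∞}` convex). -/
def IsLogConcave {n : ℕ} (μ : Measure (En n)) : Prop :=
  ∃ (s : Set (En n)) (W : En n → ℝ), Convex ℝ s ∧ ConvexOn ℝ s W ∧
    μ = volume.withDensity (s.indicator fun x => ENNReal.ofReal (Real.exp (-W x)))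

/-- The Laplacian of `F`. -/
def laplacian {n : ℕ} (F : En n → ℝ) (x : En n) : ℝ :=
  ∑ i : Fin n,
    fderiv ℝ (fun y => fderiv ℝ F y (EuclideanSpace.single i (1 : ℝ))) x
      (EuclideanSpace.single i (1 : ℝ))

/-- The generator `A F = ΔF - ∇V·∇F` associated with `μ = e^{-V} dx`. -/
def genA {n : ℕ} (V F : En n → ℝ) (x : En n) : ℝ :=
  laplacian F x - ⟪gradient V x, gradient F x⟫

/-- The centered Gaussian measure on ℝ^n with covariance matrix `σ² Id`. -/
def gaussMeasure (n : ℕ) (σ : ℝ) : Measure (En n) :=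
  volume.withDensity fun x =>
    ENNReal.ofReal ((2 * π * σ ^ 2) ^ (-(n : ℝ) / 2) * Real.exp (-‖x‖ ^ 2 / (2 * σ ^ 2)))

/-- Convolution of two measures. -/
def mconv {n : ℕ} (μ ν : Measure (En n)) : Measure (En n) :=
  (μ.prod ν).map fun p => p.1 + p.2

/-- Concentration profile of `μ`. -/
def concProfile {n : ℕ} (μ : Measure (En n)) (r : ℝ) : ℝ :=
  sSup {t | ∃ A : Set (En n), MeasurableSet A ∧ (1 : ℝ) / 2 ≤ (μ A).toReal ∧
    t = 1 - (μ (A + Metric.ball (0 : En n) r)).toReal}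

/-- Generalized inverse of the concentration profile. -/
def concInv {n : ℕ} (μ : Measure (En n)) (s : ℝ) : ℝ :=
  sInf {r | 0 < r ∧ concProfile μ r ≤ s}

/-- The Hessian matrix of `V` at `x`. -/
def hessMat {n : ℕ} (V : En n → ℝ) (x : En n) : Matrix (Fin n) (Fin n) ℝ :=
  fun i j =>
    fderiv ℝ (fun y => fderiv ℝ V y (EuclideanSpace.single j (1 : ℝ))) x
      (EuclideanSpace.single i (1 : ℝ))

end


theorem le_of_hasDerivAt_nonneg_off_point {g g' : ℝ → ℝ} (p : ℝ) (hc : Continuous g)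
    (hd : ∀ s, 0 < s → s ≠ p → HasDerivAt g (g' s) s) (h : ∀ s, 0 < s → s ≠ p → 0 ≤ g' s)
    {t : ℝ} (ht : 0 ≤ t) : g 0 ≤ g t := by
  have key : ∀ a b : ℝ, 0 ≤ a → a ≤ b → p ∉ Ioo a b → g a ≤ g b := by
    intro a b ha hab hp
    have hne : ∀ s ∈ interior (Icc a b), 0 < s ∧ s ≠ p := by
      intro s hs
      rw [interior_Icc] at hs
      exact ⟨ha.trans_lt hs.1, fun e => hp (e ▸ hs)⟩
    refine monotoneOn_of_deriv_nonneg (convex_Icc a b) hc.continuousOn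
      (fun s hs => ((hd s (hne s hs).1 (hne s hs).2).differentiableAt).differentiableWithinAt)
      (fun s hs => ?_) (left_mem_Icc.2 hab) (right_mem_Icc.2 hab) hab
    rw [(hd s (hne s hs).1 (hne s hs).2).deriv]
    exact h s (hne s hs).1 (hne s hs).2
  by_cases hp : p ∈ Ioo 0 t
  · exact (key 0 p le_rfl hp.1.le (by simp)).trans (key p t hp.1.le hp.2.le (by simp))
  · exact key 0 t le_rfl ht hp

theorem sq_mul_log_sub_le {x y a : ℝ} (hx : x ≠ 0) (ha : 0 < a) :
    y ^ 2 * (2 * log x - log a - 2 * log y) ≤ x ^ 2 / a - y ^ 2 := by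
  rcases eq_or_ne y 0 with rfl | hy
  · simp only [ne_eq, OfNat.ofNat_ne_zero, not_false_eq_true, zero_pow, zero_mul, sub_zero]
    positivity
  have hpos : 0 < x ^ 2 / (a * y ^ 2) := by positivity
  have h1 := Real.log_le_sub_one_of_pos hpos
  rw [Real.log_div (by positivity) (by positivity), Real.log_mul ha.ne' (by positivity),
    Real.log_pow, Real.log_pow] at h1
  push_cast at h1
  calc y ^ 2 * (2 * log x - log a - 2 * log y)
      = y ^ 2 * (2 * log x - (log a + 2 * log y)) := by ring
    _ ≤ y ^ 2 * (x ^ 2 / (a * y ^ 2) - 1) := by gcongr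
    _ = x ^ 2 / a - y ^ 2 := by field_simp

theorem exists_one_add_mul_sq_log_le_of_nonneg {t : ℝ} (ht : 0 ≤ t) : ∃ d : ℝ, ∀ y : ℝ,
    2 * (1 + t * y) ^ 2 * log (1 + t * y) ≤ 2 * t ^ 2 * y ^ 2 * log y
      + y ^ 2 * ((1 + t ^ 2) * log (1 + t ^ 2) + 2 * t ^ 2) + t ^ 2 * (1 - y ^ 2) + d * y := by
  refine ⟨2 * t * log (1 + t ^ 2) - 2 * t + 4 * arctan t, fun y => ?_⟩
  have hx : ∀ s : ℝ, s ≠ -1 / y → 1 + s * y ≠ 0 := by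
    intro s hs h0
    apply hs
    have hy : y ≠ 0 := by rintro rfl; simp at h0
    field_simp
    linarith
  have hlin : ∀ s : ℝ, HasDerivAt (fun s : ℝ => 1 + s * y) y s := fun s => by
    simpa using ((hasDerivAt_id s).mul_const y).const_add 1
  have hsq : ∀ s : ℝ, HasDerivAt (fun s : ℝ => 1 + s ^ 2) (2 * s) s := fun s => by
    simpa using (hasDerivAt_pow 2 s).const_add 1
  have hlogsq : ∀ s : ℝ, HasDerivAt (fun s : ℝ => log (1 + s ^ 2)) (2 * s / (1 + s ^ 2)) s :=
    fun s => (hsq s).log (by positivity)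
  have hclog : Continuous fun s : ℝ => log (1 + s ^ 2) :=
    Continuous.log (by fun_prop) fun s => by positivity
  have hcml : Continuous fun s : ℝ => (1 + s * y) * log (1 + s * y) :=
    Real.continuous_mul_log.comp (by fun_prop : Continuous fun s : ℝ => 1 + s * y)
  set Ψ : ℝ → ℝ := fun s => 4 * s * y ^ 2 * log y + y ^ 2 * (2 * s * log (1 + s ^ 2) + 6 * s)
    + 2 * s * (1 - y ^ 2) + (2 * log (1 + s ^ 2) + 2) * y
    - 2 * y * (2 * ((1 + s * y) * log (1 + s * y)) + (1 + s * y)) with hΨ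
  have hΨ0 : ∀ s, 0 ≤ s → 0 ≤ Ψ s := by
    intro s hs
    have h0 : Ψ 0 = 0 := by simp [hΨ, mul_comm]
    rw [← h0]
    refine le_of_hasDerivAt_nonneg_off_point (g := Ψ)
      (g' := fun s => 4 * y ^ 2 * log y
        + y ^ 2 * (2 * log (1 + s ^ 2) + 2 * s * (2 * s / (1 + s ^ 2)) + 6) + 2 * (1 - y ^ 2)
        + 2 * (2 * s / (1 + s ^ 2)) * y - 2 * y ^ 2 * (2 * log (1 + s * y) + 3))
      (-1 / y) (by fun_prop) ?_ ?_ hs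
    · intro s _ hsp
      have hxs := hx s hsp
      have hi := hasDerivAt_id' s
      have := (((((hi.const_mul 4).mul_const (y ^ 2)).mul_const (log y)).add
        ((((hi.const_mul 2).mul (hlogsq s)).add (hi.const_mul 6)).const_mul (y ^ 2))).add
        ((hi.const_mul 2).mul_const (1 - y ^ 2))).add
        ((((hlogsq s).const_mul 2).add_const 2).mul_const y) |>.sub
        (((((hlin s).mul ((hlin s).log hxs)).const_mul 2).add (hlin s)).const_mul (2 * y))
      refine this.congr_deriv ?_
      rw [mul_div_cancel₀ _ hxs]
      ring
    · intro s hs hsp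
      have hxs := hx s hsp
      have hg := sq_mul_log_sub_le (y := y) hxs (a := 1 + s ^ 2) (by positivity)
      have e : y ^ 2 * (2 * s * (2 * s / (1 + s ^ 2))) + 2 * (1 - y ^ 2)
          + 2 * (2 * s / (1 + s ^ 2)) * y - 2 * ((1 + s * y) ^ 2 / (1 + s ^ 2) - y ^ 2)
          = (2 * s ^ 2 + 2 * s ^ 2 * y ^ 2) / (1 + s ^ 2) := by
        field_simp
        ring
      have e' : 0 ≤ (2 * s ^ 2 + 2 * s ^ 2 * y ^ 2) / (1 + s ^ 2) := by positivity
      nlinarith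
  set Φ : ℝ → ℝ := fun s => 2 * s ^ 2 * y ^ 2 * log y
      + y ^ 2 * ((1 + s ^ 2) * log (1 + s ^ 2) + 2 * s ^ 2) + s ^ 2 * (1 - y ^ 2)
      + (2 * s * log (1 + s ^ 2) - 2 * s + 4 * arctan s) * y
      - 2 * (1 + s * y) * ((1 + s * y) * log (1 + s * y)) with hΦ
  have hΦ0 : Φ 0 ≤ Φ t := by
    refine le_of_hasDerivAt_nonneg_off_point (g := Φ) (g' := Ψ) (-1 / y) (by fun_prop) ?_
      (fun s hs _ => hΨ0 s hs.le) ht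
    intro s _ hsp
    have hxs := hx s hsp
    have hi := hasDerivAt_id' s
    have hp := hasDerivAt_pow 2 s
    have := (((((hp.const_mul 2).mul_const (y ^ 2)).mul_const (log y)).add
        ((((hsq s).mul (hlogsq s)).add (hp.const_mul 2)).const_mul (y ^ 2))).add
        (hp.mul_const (1 - y ^ 2))).add
        (((((hi.const_mul 2).mul (hlogsq s)).sub (hi.const_mul 2)).add
          ((hasDerivAt_arctan s).const_mul 4)).mul_const y) |>.sub
        (((hlin s).const_mul 2).mul ((hlin s).mul ((hlin s).log hxs)))
    refine this.congr_deriv ?_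
    simp only [hΨ, Pi.mul_apply, mul_div_cancel₀ _ hxs]
    field_simp
    push_cast
    ring
  have h0 : Φ 0 = 0 := by simp [hΦ]
  rw [h0] at hΦ0
  simp only [hΦ] at hΦ0
  linarith

theorem exists_one_add_mul_sq_log_le (t : ℝ) : ∃ d : ℝ, ∀ y : ℝ,
    2 * (1 + t * y) ^ 2 * log (1 + t * y) ≤ 2 * t ^ 2 * y ^ 2 * log y
      + y ^ 2 * ((1 + t ^ 2) * log (1 + t ^ 2) + 2 * t ^ 2) + t ^ 2 * (1 - y ^ 2) + d * y := by
  rcases le_total 0 t with ht | ht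
  · exact exists_one_add_mul_sq_log_le_of_nonneg ht
  · obtain ⟨d, hd⟩ := exists_one_add_mul_sq_log_le_of_nonneg (neg_nonneg.2 ht)
    refine ⟨-d, fun y => ?_⟩
    have := hd (-y)
    simp only [neg_mul_neg, neg_sq, Real.log_neg_eq_log] at this
    linarith

theorem integrable_sq_mul_log_sq {Ω : Type*} [MeasurableSpace Ω] {ν : Measure Ω}
    [IsFiniteMeasure ν] {f : Ω → ℝ} (hf : Measurable f) {M : ℝ} (hM : ∀ x, |f x| ≤ M) :
    Integrable (fun x => f x ^ 2 * log (f x ^ 2)) ν := by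
  have hc : Continuous fun u : ℝ => u ^ 2 * log (u ^ 2) :=
    Real.continuous_mul_log.comp (by fun_prop : Continuous fun u : ℝ => u ^ 2)
  obtain ⟨C, hC⟩ := (isCompact_Icc (a := -M) (b := M)).exists_bound_of_continuousOn hc.continuousOn
  exact Integrable.of_bound (hc.measurable.comp hf).aestronglyMeasurable C
    (.of_forall fun x => hC _ (abs_le.1 (hM x)))

/-- Rothaus' lemma. -/
theorem entropy_sq_le_entropy_sq_sub_integral_add {Ω : Type*} [MeasurableSpace Ω] {ν : Measure Ω}
    [IsProbabilityMeasure ν] {f : Ω → ℝ} (hf : Measurable f) {M : ℝ} (hM : ∀ x, |f x| ≤ M)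
    {c : ℝ} (hc : ∫ x, f x ∂ν = c) :
    (∫ x, f x ^ 2 * log (f x ^ 2) ∂ν) - (∫ x, f x ^ 2 ∂ν) * log (∫ x, f x ^ 2 ∂ν)
      ≤ (∫ x, (f x - c) ^ 2 * log ((f x - c) ^ 2) ∂ν)
        - (∫ x, (f x - c) ^ 2 ∂ν) * log (∫ x, (f x - c) ^ 2 ∂ν)
        + 2 * ∫ x, (f x - c) ^ 2 ∂ν := by
  have hMc : ∀ x, |f x - c| ≤ M + |c| := fun x => (abs_sub _ _).trans (by gcongr; exact hM x)
  have hfc : Measurable fun x => f x - c := hf.sub_const c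
  have hi : Integrable f ν := Integrable.of_bound hf.aestronglyMeasurable M (.of_forall hM)
  have hiz : Integrable (fun x => f x - c) ν := hi.sub (integrable_const c)
  have hiz2 : Integrable (fun x => (f x - c) ^ 2) ν :=
    Integrable.of_bound (hfc.pow_const 2).aestronglyMeasurable ((M + |c|) ^ 2)
      (.of_forall fun x => by
        rw [norm_pow]; exact pow_le_pow_left₀ (norm_nonneg _) (hMc x) 2)
  have hif2 : Integrable (fun x => f x ^ 2) ν :=
    Integrable.of_bound (hf.pow_const 2).aestronglyMeasurable (M ^ 2)
      (.of_forall fun x => by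
        rw [norm_pow]; exact pow_le_pow_left₀ (norm_nonneg _) (hM x) 2)
  have hint0 : ∫ x, (f x - c) ∂ν = 0 := by
    rw [integral_sub hi (integrable_const c), hc]; simp
  obtain ⟨v, hv⟩ : ∃ v, ∫ x, (f x - c) ^ 2 ∂ν = v := ⟨_, rfl⟩
  have hv0 : 0 ≤ v := hv ▸ integral_nonneg fun x => sq_nonneg _
  have hf2 : ∫ x, f x ^ 2 ∂ν = c ^ 2 + v := by
    have : ∀ x, f x ^ 2 = (f x - c) ^ 2 + 2 * c * (f x - c) + c ^ 2 := fun x => by ring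
    simp_rw [this]
    rw [integral_add (hiz2.fun_add (hiz.const_mul _)) (integrable_const _),
      integral_add hiz2 (hiz.const_mul _), integral_const_mul, hint0, hv]
    simp; ring
  rw [hf2, hv]
  rcases eq_or_ne c 0 with rfl | hc0
  · simp only [sub_zero, ne_eq, OfNat.ofNat_ne_zero, not_false_eq_true, zero_pow, zero_add]
    linarith
  rcases hv0.eq_or_lt with rfl | hvpos
  · have hae : ∀ᵐ x ∂ν, f x = c := by
      have := (integral_eq_zero_iff_of_nonneg (fun x => sq_nonneg (f x - c)) hiz2).1 hv
      filter_upwards [this] with x hx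
      have : f x - c = 0 := by simpa using hx
      linarith
    have e1 : ∫ x, f x ^ 2 * log (f x ^ 2) ∂ν = c ^ 2 * log (c ^ 2) := by
      rw [integral_congr_ae (g := fun _ => c ^ 2 * log (c ^ 2))
        (hae.mono fun x hx => by simp [hx])]
      simp
    have e2 : ∫ x, (f x - c) ^ 2 * log ((f x - c) ^ 2) ∂ν = 0 := by
      rw [integral_congr_ae (g := fun _ => (0 : ℝ)) (hae.mono fun x hx => by simp [hx])]
      simp
    rw [e1, e2]
    simp
  have hs : √v ≠ 0 := (Real.sqrt_pos.2 hvpos).ne'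
  have hs2 : √v ^ 2 = v := Real.sq_sqrt hv0
  obtain ⟨d, hd⟩ := exists_one_add_mul_sq_log_le (√v / c)
  have ht2 : 1 + (√v / c) ^ 2 = (c ^ 2 + v) / c ^ 2 := by
    rw [div_pow, hs2]; field_simp
  have hlt : log (1 + (√v / c) ^ 2) = log (c ^ 2 + v) - log (c ^ 2) := by
    rw [ht2, Real.log_div (by positivity) (by positivity)]
  have hpt : ∀ x, f x ^ 2 * log (f x ^ 2) ≤ (f x - c) ^ 2 * log ((f x - c) ^ 2)
      + ((c ^ 2 + v) / v * (log (c ^ 2 + v) - log (c ^ 2)) + 2 - log v - 1) * (f x - c) ^ 2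
      + c ^ 2 * d / √v * (f x - c) + v + log (c ^ 2) * f x ^ 2 := by
    intro x
    have h := hd ((f x - c) / √v)
    have hx : 1 + √v / c * ((f x - c) / √v) = f x / c := by field_simp; ring
    rw [hx, hlt] at h
    have h1 : f x ^ 2 * log (f x ^ 2) = c ^ 2 * (2 * (f x / c) ^ 2 * log (f x / c))
        + log (c ^ 2) * f x ^ 2 := by
      rcases eq_or_ne (f x) 0 with h0 | h0
      · simp [h0]
      rw [Real.log_div h0 hc0, Real.log_pow, Real.log_pow]
      field_simp
      push_cast
      ring
    have h2 : 2 * (√v / c) ^ 2 * ((f x - c) / √v) ^ 2 * log ((f x - c) / √v) * c ^ 2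
        = (f x - c) ^ 2 * log ((f x - c) ^ 2) - log v * (f x - c) ^ 2 := by
      rcases eq_or_ne (f x - c) 0 with h0 | h0
      · simp [h0]
      rw [Real.log_div h0 hs, Real.log_pow, Real.log_sqrt hv0]
      field_simp
      push_cast
      ring
    have h3 := mul_le_mul_of_nonneg_left h (sq_nonneg c)
    have h4 : c ^ 2 * (((f x - c) / √v) ^ 2 * ((1 + (√v / c) ^ 2) * (log (c ^ 2 + v) - log (c ^ 2))
          + 2 * (√v / c) ^ 2) + (√v / c) ^ 2 * (1 - ((f x - c) / √v) ^ 2) + d * ((f x - c) / √v))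
        = ((c ^ 2 + v) / v * (log (c ^ 2 + v) - log (c ^ 2)) + 2 - 1) * (f x - c) ^ 2
          + c ^ 2 * d / √v * (f x - c) + v := by
      rw [ht2]
      simp only [div_pow, hs2]
      field_simp
      ring
    linarith
  have I1 := integrable_sq_mul_log_sq (ν := ν) hf hM
  have I2 := integrable_sq_mul_log_sq (ν := ν) hfc hMc
  have J1 := I2.fun_add (hiz2.const_mul
    ((c ^ 2 + v) / v * (log (c ^ 2 + v) - log (c ^ 2)) + 2 - log v - 1))
  have J2 := J1.fun_add (hiz.const_mul (c ^ 2 * d / √v))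
  have J3 := J2.fun_add (integrable_const v)
  have J4 := J3.fun_add (hif2.const_mul (log (c ^ 2)))
  have := integral_mono I1 J4 hpt
  rw [integral_add J3 (hif2.const_mul (log (c ^ 2))), integral_add J2 (integrable_const v),
    integral_add J1 (hiz.const_mul (c ^ 2 * d / √v)), integral_add I2 (hiz2.const_mul _),
    integral_const_mul, integral_const_mul, integral_const_mul, hint0, hv, hf2] at this
  simp only [integral_const, probReal_univ, smul_eq_mul, mul_zero, one_mul] at this
  have e : ((c ^ 2 + v) / v * (log (c ^ 2 + v) - log (c ^ 2)) + 2 - log v - 1) * v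
      = (c ^ 2 + v) * (log (c ^ 2 + v) - log (c ^ 2)) + 2 * v - v * log v - v := by
    field_simp
  linarith

theorem norm_gradient_eq_norm_fderiv {n : ℕ} (f : En n → ℝ) (x : En n) :
    ‖gradient f x‖ = ‖fderiv ℝ f x‖ := by
  simp [gradient]

theorem inner_gradient_eq_fderiv {n : ℕ} (f : En n → ℝ) (x v : En n) :
    ⟪gradient f x, v⟫ = fderiv ℝ f x v := by
  simp [gradient]

/-- Defective logarithmic Sobolev inequalities pass to bounded pointwise limits in `C¹`. -/
theorem defective_logSobolev_of_tendsto {n : ℕ} {ν : Measure (En n)} [IsProbabilityMeasure ν]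
    {a c k M B : ℝ} {f : En n → ℝ} {g : ℕ → En n → ℝ} (hg : ∀ i, ContDiff ℝ 1 (g i))
    (hM : ∀ i x, |g i x| ≤ M) (hB : ∀ i x, ‖fderiv ℝ (g i) x‖ ≤ B)
    (hlim : ∀ x, Filter.Tendsto (fun i => g i x) Filter.atTop (nhds (f x)))
    (hlim' : ∀ x, Filter.Tendsto (fun i => fderiv ℝ (g i) x) Filter.atTop (nhds (fderiv ℝ f x)))
    (h : ∀ i, a * ((∫ x, g i x ^ 2 * log (g i x ^ 2) ∂ν)
        - (∫ x, g i x ^ 2 ∂ν) * log (∫ x, g i x ^ 2 ∂ν))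
      ≤ c * (∫ x, ‖gradient (g i) x‖ ^ 2 ∂ν) + k * ∫ x, g i x ^ 2 ∂ν) :
    a * ((∫ x, f x ^ 2 * log (f x ^ 2) ∂ν) - (∫ x, f x ^ 2 ∂ν) * log (∫ x, f x ^ 2 ∂ν))
      ≤ c * (∫ x, ‖gradient f x‖ ^ 2 ∂ν) + k * ∫ x, f x ^ 2 ∂ν := by
  simp only [norm_gradient_eq_norm_fderiv] at h ⊢
  have hc : Continuous fun u : ℝ => u ^ 2 * log (u ^ 2) :=
    Real.continuous_mul_log.comp (by fun_prop : Continuous fun u : ℝ => u ^ 2)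
  obtain ⟨C, hC⟩ := (isCompact_Icc (a := -M) (b := M)).exists_bound_of_continuousOn hc.continuousOn
  have L1 : Filter.Tendsto (fun i => ∫ x, g i x ^ 2 * log (g i x ^ 2) ∂ν) Filter.atTop
      (nhds (∫ x, f x ^ 2 * log (f x ^ 2) ∂ν)) :=
    tendsto_integral_of_dominated_convergence (fun _ => C)
      (fun i => (hc.comp (hg i).continuous).aestronglyMeasurable) (integrable_const _)
      (fun i => .of_forall fun x => hC _ (abs_le.1 (hM i x)))
      (.of_forall fun x => (hc.tendsto _).comp (hlim x))
  have L2 : Filter.Tendsto (fun i => ∫ x, g i x ^ 2 ∂ν) Filter.atTop (nhds (∫ x, f x ^ 2 ∂ν)) :=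
    tendsto_integral_of_dominated_convergence (fun _ => M ^ 2)
      (fun i => ((hg i).continuous.pow 2).aestronglyMeasurable) (integrable_const _)
      (fun i => .of_forall fun x => by
        rw [norm_pow]; exact pow_le_pow_left₀ (norm_nonneg _) (hM i x) 2)
      (.of_forall fun x => (hlim x).pow 2)
  have L3 : Filter.Tendsto (fun i => ∫ x, ‖fderiv ℝ (g i) x‖ ^ 2 ∂ν) Filter.atTop
      (nhds (∫ x, ‖fderiv ℝ f x‖ ^ 2 ∂ν)) :=
    tendsto_integral_of_dominated_convergence (fun _ => B ^ 2)
      (fun i => ((((hg i).continuous_fderiv one_ne_zero).norm).pow 2).aestronglyMeasurable)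
      (integrable_const _)
      (fun i => .of_forall fun x => by
        rw [norm_pow, norm_norm]; exact pow_le_pow_left₀ (norm_nonneg _) (hB i x) 2)
      (.of_forall fun x => (hlim' x).norm.pow 2)
  exact le_of_tendsto_of_tendsto'
    ((L1.sub ((Real.continuous_mul_log.tendsto _).comp L2)).const_mul a)
    ((L3.const_mul c).add (L2.const_mul k)) h

theorem isTestFun_of_hasCompactSupport {n : ℕ} {f : En n → ℝ} (hf : ContDiff ℝ (⊤ : ℕ∞) f)
    (hfc : HasCompactSupport f) : IsTestFun f :=
  ⟨hf, hfc.exists_bound_of_continuous hf.continuous,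
    hf.lipschitzWith_of_hasCompactSupport hfc (by simp)⟩

open ContinuousLinearMap in
open scoped Convolution in
theorem exists_isTestFun_tendsto {n : ℕ} {f : En n → ℝ} (hf : ContDiff ℝ 1 f)
    (hfc : HasCompactSupport f) : ∃ (g : ℕ → En n → ℝ) (M B : ℝ), (∀ i, IsTestFun (g i)) ∧
      (∀ i x, |g i x| ≤ M) ∧ (∀ i x, ‖fderiv ℝ (g i) x‖ ≤ B) ∧
      (∀ x, Filter.Tendsto (fun i => g i x) Filter.atTop (nhds (f x))) ∧
      ∀ x, Filter.Tendsto (fun i => fderiv ℝ (g i) x) Filter.atTop (nhds (fderiv ℝ f x)) := by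
  let φ : ℕ → ContDiffBump (0 : En n) := fun i =>
    ⟨1 / (2 * ((i : ℝ) + 1)), 1 / ((i : ℝ) + 1), by positivity, by
      gcongr; linarith [(Nat.cast_nonneg i : (0 : ℝ) ≤ i)]⟩
  have hφ : Filter.Tendsto (fun i => (φ i).rOut) Filter.atTop (nhds 0) :=
    tendsto_one_div_add_atTop_nhds_zero_nat
  have hf' : Continuous (fderiv ℝ f) := hf.continuous_fderiv one_ne_zero
  have hderiv : ∀ i x, fderiv ℝ ((φ i).normed volume ⋆[lsmul ℝ ℝ, volume] f) x
      = ((φ i).normed volume ⋆[lsmul ℝ ℝ, volume] (fderiv ℝ f)) x := by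
    intro i x
    have := (hfc.hasFDerivAt_convolution_right (lsmul ℝ ℝ) (μ := volume)
      ((φ i).continuous_normed (μ := volume)).locallyIntegrable hf x).fderiv
    rw [this]
    rfl
  obtain ⟨M, hM⟩ := hfc.exists_bound_of_continuous hf.continuous
  obtain ⟨B, hB⟩ := (hfc.fderiv ℝ).exists_bound_of_continuous hf'
  refine ⟨fun i => (φ i).normed volume ⋆[lsmul ℝ ℝ, volume] f, M, B, fun i => ?_, fun i x => ?_,
    fun i x => ?_, fun x => ?_, fun x => ?_⟩
  · exact isTestFun_of_hasCompactSupport ((φ i).hasCompactSupport_normed.contDiff_convolution_left _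
      (φ i).contDiff_normed hf.continuous.locallyIntegrable)
      ((φ i).hasCompactSupport_normed.convolution _ hfc)
  · have := dist_convolution_le (z₀ := 0) (x₀ := x) (g := f) (μ := volume)
      ((norm_nonneg _).trans (hM 0)) (φ i).support_normed_eq.subset (φ i).nonneg_normed
      (φ i).integral_normed hf.continuous.aestronglyMeasurable
      (fun y _ => by simpa using hM y)
    simpa using this
  · have := dist_convolution_le (z₀ := 0) (x₀ := x) (g := fderiv ℝ f) (μ := volume)
      ((norm_nonneg _).trans (hB 0)) (φ i).support_normed_eq.subset (φ i).nonneg_normed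
      (φ i).integral_normed hf'.aestronglyMeasurable
      (fun y _ => by simpa using hB y)
    rw [hderiv]
    simpa using this
  · exact ContDiffBump.convolution_tendsto_right_of_continuous hφ hf.continuous x
  · simp only [hderiv]
    exact ContDiffBump.convolution_tendsto_right_of_continuous hφ hf' x

theorem LogSobolevLE.of_contDiff_one {n : ℕ} {μ : Measure (En n)} [IsProbabilityMeasure μ] {C : ℝ}
    (h : LogSobolevLE μ C) {f : En n → ℝ} (hf : ContDiff ℝ 1 f) (hfc : HasCompactSupport f) :
    (∫ x, f x ^ 2 * log (f x ^ 2) ∂μ) - (∫ x, f x ^ 2 ∂μ) * log (∫ x, f x ^ 2 ∂μ)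
      ≤ C * ∫ x, ‖gradient f x‖ ^ 2 ∂μ := by
  obtain ⟨g, M, B, hg, hM, hB, hlim, hlim'⟩ := exists_isTestFun_tendsto hf hfc
  have := defective_logSobolev_of_tendsto (ν := μ) (a := 1) (c := C) (k := 0)
    (fun i => (hg i).1.of_le (by simp)) hM hB hlim hlim'
    (fun i => by simpa using h (g i) (hg i))
  simpa using this

theorem exists_cutoff_tendsto {n : ℕ} {f : En n → ℝ} (hf : IsTestFun f) :
    ∃ (g : ℕ → En n → ℝ) (M B : ℝ), (∀ i, ContDiff ℝ 1 (g i)) ∧ (∀ i, HasCompactSupport (g i)) ∧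
      (∀ i x, |g i x| ≤ M) ∧ (∀ i x, ‖fderiv ℝ (g i) x‖ ≤ B) ∧
      (∀ x, Filter.Tendsto (fun i => g i x) Filter.atTop (nhds (f x))) ∧
      ∀ x, Filter.Tendsto (fun i => fderiv ℝ (g i) x) Filter.atTop (nhds (fderiv ℝ f x)) := by
  obtain ⟨hfs, ⟨M, hM⟩, L, hL⟩ := hf
  have hf1 : ContDiff ℝ 1 f := hfs.of_le (by simp)
  have hM0 : 0 ≤ M := (abs_nonneg _).trans (hM 0)
  let χ : ContDiffBump (0 : En n) := ⟨1, 2, by norm_num, by norm_num⟩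
  have hχ : ContDiff ℝ 1 χ := χ.contDiff
  obtain ⟨K, hK⟩ := (χ.hasCompactSupport.fderiv ℝ).exists_bound_of_continuous
    (hχ.continuous_fderiv one_ne_zero)
  have hK0 : 0 ≤ K := (norm_nonneg _).trans (hK 0)
  let r : ℕ → ℝ := fun i => ((i : ℝ) + 1)⁻¹
  have hr0 : ∀ i, 0 < r i := fun i => by positivity
  have hr1 : ∀ i, r i ≤ 1 := fun i => inv_le_one_of_one_le₀ (by simp)
  have hscale : ∀ i, ContDiff ℝ 1 fun x : En n => χ (r i • x) := fun i =>
    hχ.comp (contDiff_const_smul (r i))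
  have hder : ∀ i x, fderiv ℝ (fun x : En n => χ (r i • x)) x = r i • fderiv ℝ χ (r i • x) :=
    fun i x => fderiv_comp_smul (f := χ) (r i)
  have hev : ∀ x : En n, ∀ᶠ i in Filter.atTop, ∀ᶠ y in nhds x, χ (r i • y) * f y = f y := by
    intro x
    obtain ⟨N, hN⟩ := exists_nat_gt ‖x‖
    filter_upwards [Filter.eventually_ge_atTop N] with i hi
    have hi' : ‖x‖ < (i : ℝ) + 1 := by
      have : (N : ℝ) ≤ i := by exact_mod_cast hi
      linarith
    filter_upwards [(continuous_norm.tendsto x).eventually_lt_const hi'] with y hy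
    rw [χ.one_of_mem_closedBall, one_mul]
    rw [mem_closedBall_zero_iff, norm_smul, Real.norm_of_nonneg (hr0 i).le]
    change ((i : ℝ) + 1)⁻¹ * ‖y‖ ≤ 1
    rw [inv_mul_le_iff₀ (by positivity)]
    linarith
  refine ⟨fun i x => χ (r i • x) * f x, M, K * M + L, fun i => (hscale i).mul hf1, fun i => ?_,
    fun i x => ?_, fun i x => ?_, fun x => ?_, fun x => ?_⟩
  · exact (χ.hasCompactSupport.comp_smul (hr0 i).ne').mul_right
  · rw [abs_mul, abs_of_nonneg χ.nonneg]
    exact (mul_le_of_le_one_left (abs_nonneg _) χ.le_one).trans (hM x)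
  · rw [fderiv_fun_mul ((hscale i).differentiable one_ne_zero x) (hf1.differentiable one_ne_zero x),
      hder]
    refine (norm_add_le _ _).trans ?_
    rw [add_comm]
    refine add_le_add ?_ ?_
    · rw [norm_smul, norm_smul, Real.norm_eq_abs, Real.norm_of_nonneg (hr0 i).le, mul_comm]
      gcongr
      · exact (mul_le_of_le_one_left (norm_nonneg _) (hr1 i)).trans (hK _)
      · exact hM x
    · rw [norm_smul, Real.norm_of_nonneg χ.nonneg]
      exact (mul_le_of_le_one_left (norm_nonneg _) χ.le_one).trans
        (norm_fderiv_le_of_lipschitz ℝ hL)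
  · exact tendsto_const_nhds.congr' ((hev x).mono fun i hi => hi.self_of_nhds.symm)
  · exact tendsto_const_nhds.congr'
      ((hev x).mono fun i hi => (Filter.EventuallyEq.fderiv_eq hi).symm)

theorem continuous_gradient {n : ℕ} {f : En n → ℝ} (hf : ContDiff ℝ 1 f) :
    Continuous (gradient f) :=
  (InnerProductSpace.toDual ℝ (En n)).symm.continuous.comp (hf.continuous_fderiv one_ne_zero)

theorem contDiff_fderiv_apply {n : ℕ} {F : En n → ℝ} (hF : ContDiff ℝ 2 F) (v : En n) :
    ContDiff ℝ 1 fun y => fderiv ℝ F y v :=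
  (hF.fderiv_right (m := 1) (by norm_num)).clm_apply contDiff_const

theorem continuous_laplacian {n : ℕ} {F : En n → ℝ} (hF : ContDiff ℝ 2 F) :
    Continuous (laplacian F) :=
  continuous_finsetSum _ fun _ _ =>
    ((contDiff_fderiv_apply hF _).continuous_fderiv one_ne_zero).clm_apply continuous_const

theorem hasCompactSupport_gradient {n : ℕ} {f : En n → ℝ} (hf : HasCompactSupport f) :
    HasCompactSupport (gradient f) :=
  (hf.fderiv ℝ).comp_left (map_zero (InnerProductSpace.toDual ℝ (En n)).symm)

/-- Green's formula for a compactly supported function. -/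
theorem integral_mul_laplacian {n : ℕ} {F w : En n → ℝ} (hF : ContDiff ℝ 2 F)
    (hw : ContDiff ℝ 1 w) (hwc : HasCompactSupport w) :
    ∫ x, w x * laplacian F x = -∫ x, ⟪gradient w x, gradient F x⟫ := by
  have hFd := fun i : Fin n => contDiff_fderiv_apply hF (EuclideanSpace.single i (1 : ℝ))
  have hwd : ∀ i : Fin n, Continuous fun x => fderiv ℝ w x (EuclideanSpace.single i (1 : ℝ)) :=
    fun _ => (hw.continuous_fderiv one_ne_zero).clm_apply continuous_const
  have hinner : ∀ x, ⟪gradient w x, gradient F x⟫ = ∑ i : Fin n,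
      fderiv ℝ w x (EuclideanSpace.single i (1 : ℝ))
        * fderiv ℝ F x (EuclideanSpace.single i (1 : ℝ)) := by
    intro x
    rw [← (EuclideanSpace.basisFun (Fin n) ℝ).sum_inner_mul_inner]
    refine Finset.sum_congr rfl fun i _ => ?_
    rw [EuclideanSpace.basisFun_apply, inner_gradient_eq_fderiv,
      real_inner_comm, inner_gradient_eq_fderiv]
  have I1 : ∀ i : Fin n, Integrable fun x => fderiv ℝ w x (EuclideanSpace.single i (1 : ℝ))
      * fderiv ℝ F x (EuclideanSpace.single i (1 : ℝ)) := fun i =>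
    ((hwd i).mul (hFd i).continuous).integrable_of_hasCompactSupport
      (hwc.fderiv_apply ℝ _).mul_right
  have I2 : ∀ i : Fin n, Integrable fun x => w x * fderiv ℝ
      (fun y => fderiv ℝ F y (EuclideanSpace.single i (1 : ℝ))) x (EuclideanSpace.single i 1) :=
    fun i => (hw.continuous.mul (((hFd i).continuous_fderiv one_ne_zero).clm_apply
      continuous_const)).integrable_of_hasCompactSupport hwc.mul_right
  have I3 : ∀ i : Fin n, Integrable fun x => w x * fderiv ℝ F x (EuclideanSpace.single i 1) :=
    fun i => (hw.continuous.mul (hFd i).continuous).integrable_of_hasCompactSupport hwc.mul_right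
  simp only [laplacian, Finset.mul_sum, hinner]
  rw [integral_finsetSum _ fun i _ => I2 i, integral_finsetSum _ fun i _ => I1 i,
    ← Finset.sum_neg_distrib]
  exact Finset.sum_congr rfl fun i _ => integral_mul_fderiv_eq_neg_fderiv_mul_of_integrable
    (I1 i) (I2 i) (I3 i) (fun x _ => hw.differentiable one_ne_zero x)
    fun x _ => (hFd i).differentiable one_ne_zero x

/-- The entropy inequality, by duality between entropy and exponential moments. -/
theorem integral_sq_mul_le_entropy_add {Ω : Type*} [MeasurableSpace Ω] {ν : Measure Ω}
    [IsProbabilityMeasure ν] {f φ : Ω → ℝ} (h1 : Integrable (fun x => f x ^ 2) ν)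
    (h2 : Integrable (fun x => f x ^ 2 * log (f x ^ 2)) ν)
    (h3 : Integrable (fun x => f x ^ 2 * φ x) ν) (h4 : Integrable (fun x => exp (φ x)) ν) :
    ∫ x, f x ^ 2 * φ x ∂ν ≤ (∫ x, f x ^ 2 * log (f x ^ 2) ∂ν)
      - (∫ x, f x ^ 2 ∂ν) * log (∫ x, f x ^ 2 ∂ν)
      + (∫ x, f x ^ 2 ∂ν) * log (∫ x, exp (φ x) ∂ν) := by
  have hZ : 0 < ∫ x, exp (φ x) ∂ν := integral_exp_pos h4
  obtain ⟨Z, hZe⟩ : ∃ Z, ∫ x, exp (φ x) ∂ν = Z := ⟨_, rfl⟩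
  obtain ⟨m, hm⟩ : ∃ m, ∫ x, f x ^ 2 ∂ν = m := ⟨_, rfl⟩
  have hm0 : 0 ≤ m := hm ▸ integral_nonneg fun x => sq_nonneg _
  rw [hZe] at hZ ⊢
  rw [hm]
  rcases hm0.eq_or_lt with rfl | hmpos
  · have hae : ∀ᵐ x ∂ν, f x = 0 := by
      filter_upwards [(integral_eq_zero_iff_of_nonneg (fun x => sq_nonneg (f x)) h1).1 hm] with x hx
      simpa using hx
    rw [integral_congr_ae (g := fun _ => (0 : ℝ)) (hae.mono fun x hx => by simp [hx]),
      integral_congr_ae (f := fun x => f x ^ 2 * log (f x ^ 2)) (g := fun _ => (0 : ℝ))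
        (hae.mono fun x hx => by simp [hx])]
    simp
  have hpt : ∀ x, f x ^ 2 * φ x ≤ f x ^ 2 * log (f x ^ 2)
      + (log Z - log m - 1) * f x ^ 2 + m / Z * exp (φ x) := by
    intro x
    rcases eq_or_ne (f x) 0 with h0 | h0
    · rw [h0]
      have : 0 ≤ m / Z * exp (φ x) := by positivity
      simpa using this
    have hf2 : 0 < f x ^ 2 := by positivity
    have h := Real.log_le_sub_one_of_pos (show 0 < m * exp (φ x) / (Z * f x ^ 2) by positivity)
    rw [Real.log_div (by positivity) (by positivity), Real.log_mul hmpos.ne' (by positivity),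
      Real.log_mul hZ.ne' hf2.ne', Real.log_exp] at h
    have h' := mul_le_mul_of_nonneg_left h hf2.le
    have e : f x ^ 2 * (m * exp (φ x) / (Z * f x ^ 2) - 1) = m / Z * exp (φ x) - f x ^ 2 := by
      field_simp
    rw [e] at h'
    linarith
  have J := h2.fun_add (h1.const_mul (log Z - log m - 1))
  have := integral_mono h3 (J.fun_add (h4.const_mul (m / Z))) hpt
  rw [integral_add J (h4.const_mul _), integral_add h2 (h1.const_mul _), integral_const_mul,
    integral_const_mul, hZe, hm, div_mul_cancel₀ _ hZ.ne'] at this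
  linarith

theorem integral_withDensity_exp_neg {n : ℕ} (m : Measure (En n)) {G : En n → ℝ}
    (hG : Continuous G) (h : En n → ℝ) :
    ∫ x, h x ∂(m.withDensity fun x => ENNReal.ofReal (exp (-G x)))
      = ∫ x, exp (-G x) * h x ∂m := by
  rw [integral_withDensity_eq_integral_toReal_smul (by fun_prop) (by simp)]
  simp [ENNReal.toReal_ofReal (exp_pos _).le]

theorem perturb_eq_withDensity {n : ℕ} {μ : Measure (En n)} {F : En n → ℝ}
    (hnorm : ∫ x, exp (-F x) ∂μ = 1) :
    perturb μ F = μ.withDensity fun x => ENNReal.ofReal (exp (-F x)) := by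
  simp [perturb, hnorm]

theorem integral_perturb {n : ℕ} {μ : Measure (En n)} {F : En n → ℝ} (hF : Continuous F)
    (hnorm : ∫ x, exp (-F x) ∂μ = 1) (h : En n → ℝ) :
    ∫ x, h x ∂(perturb μ F) = ∫ x, exp (-F x) * h x ∂μ := by
  rw [perturb_eq_withDensity hnorm, integral_withDensity_exp_neg μ hF]

theorem isProbabilityMeasure_perturb {n : ℕ} {μ : Measure (En n)} {F : En n → ℝ}
    (hnorm : ∫ x, exp (-F x) ∂μ = 1) : IsProbabilityMeasure (perturb μ F) := by
  have hi : Integrable (fun x => exp (-F x)) μ := by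
    by_contra h
    rw [integral_undef h] at hnorm
    exact zero_ne_one hnorm
  constructor
  rw [perturb_eq_withDensity hnorm, withDensity_apply _ MeasurableSet.univ, Measure.restrict_univ,
    ← ofReal_integral_eq_lintegral_ofReal hi (.of_forall fun x => (exp_pos _).le), hnorm,
    ENNReal.ofReal_one]

/-- Integration by parts for the perturbed measure: its generator is `A - ∇F · ∇`. -/
theorem integral_perturb_sq_mul_generator_eq_zero {n : ℕ} {μ : Measure (En n)} {V F : En n → ℝ}
    (hV : ContDiff ℝ 1 V) (hμ : μ = volume.withDensity fun x => ENNReal.ofReal (exp (-V x)))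
    (hF : ContDiff ℝ 2 F) (hnorm : ∫ x, exp (-F x) ∂μ = 1) {f : En n → ℝ} (hf : ContDiff ℝ 1 f)
    (hfc : HasCompactSupport f) :
    ∫ x, (f x ^ 2 * (genA V F x - ‖gradient F x‖ ^ 2) + 2 * f x * ⟪gradient f x, gradient F x⟫)
      ∂(perturb μ F) = 0 := by
  have hF1 : ContDiff ℝ 1 F := hF.of_le (by norm_num)
  rw [integral_perturb hF.continuous hnorm, hμ, integral_withDensity_exp_neg _ hV.continuous]
  set w : En n → ℝ := fun x => f x ^ 2 * exp (-(F x + V x)) with hw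
  have hw1 : ContDiff ℝ 1 w := (hf.pow 2).mul (hF1.add hV).neg.exp
  have hwc : HasCompactSupport w :=
    (hfc.comp_left (g := fun u : ℝ => u ^ 2) (by simp)).mul_right
  have hderiv : ∀ x, ⟪gradient w x, gradient F x⟫ = exp (-(F x + V x)) *
      (2 * f x * ⟪gradient f x, gradient F x⟫
        - f x ^ 2 * (‖gradient F x‖ ^ 2 + ⟪gradient V x, gradient F x⟫)) := by
    intro x
    have h := (((hf.differentiable one_ne_zero x).hasFDerivAt.pow 2).mul
      (((hF1.differentiable one_ne_zero x).hasFDerivAt.add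
        (hV.differentiable one_ne_zero x).hasFDerivAt).neg.exp)).fderiv
    rw [← real_inner_self_eq_norm_sq]
    simp only [inner_gradient_eq_fderiv]
    have h' : fderiv ℝ w x = _ := h
    rw [h']
    simp
    ring
  have hibp := integral_mul_laplacian hF hw1 hwc
  have I1 : Integrable fun x => w x * laplacian F x :=
    (hw1.continuous.mul (continuous_laplacian hF)).integrable_of_hasCompactSupport hwc.mul_right
  have I2 : Integrable fun x => ⟪gradient w x, gradient F x⟫ :=
    ((continuous_gradient hw1).inner (continuous_gradient hF1)).integrable_of_hasCompactSupport
      ((hasCompactSupport_gradient hwc).mono' fun x hx => subset_tsupport _ fun h0 => hx (by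
        simp [h0]))
  rw [eq_neg_iff_add_eq_zero, ← integral_add I1 I2] at hibp
  rw [← hibp]
  refine integral_congr_ae (.of_forall fun x => ?_)
  simp only [hderiv]
  simp only [hw, genA, neg_add, exp_add]
  ring

theorem continuous_genA {n : ℕ} {V F : En n → ℝ} (hV : ContDiff ℝ 1 V) (hF : ContDiff ℝ 2 F) :
    Continuous (genA V F) :=
  (continuous_laplacian hF).sub
    ((continuous_gradient hV).inner (continuous_gradient (hF.of_le (by norm_num))))

theorem gradient_mul_exp_neg_half {n : ℕ} {f F : En n → ℝ} {x : En n}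
    (hf : DifferentiableAt ℝ f x) (hF : DifferentiableAt ℝ F x) :
    gradient (fun x => f x * exp (-F x / 2)) x
      = exp (-F x / 2) • (gradient f x - (f x / 2) • gradient F x) := by
  have h : HasFDerivAt (fun x => f x * exp (-F x / 2))
      (exp (-F x / 2) • (fderiv ℝ f x - (f x / 2) • fderiv ℝ F x)) x := by
    have hG : HasFDerivAt (fun x => -F x / 2) ((-2⁻¹ : ℝ) • fderiv ℝ F x) x := by
      refine (hF.hasFDerivAt.const_mul (-2⁻¹ : ℝ)).congr_of_eventuallyEq (.of_forall fun y => ?_)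
      ring
    refine (hf.hasFDerivAt.fun_mul hG.exp).congr_fderiv ?_
    ext v
    simp
    ring
  apply (InnerProductSpace.toDual ℝ (En n)).injective
  rw [toDual_gradient, h.fderiv]
  simp [toDual_gradient]

/-- The logarithmic Sobolev inequality of `μ` applied to `f e^{-F/2}`. -/
theorem LogSobolevLE.entropy_perturb_le {n : ℕ} {μ : Measure (En n)} [IsProbabilityMeasure μ]
    {V F : En n → ℝ} (hV : ContDiff ℝ 1 V)
    (hμ : μ = volume.withDensity fun x => ENNReal.ofReal (exp (-V x)))
    (hF : ContDiff ℝ 2 F) (hnorm : ∫ x, exp (-F x) ∂μ = 1) {C : ℝ} (h : LogSobolevLE μ C)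
    {f : En n → ℝ} (hf : ContDiff ℝ 1 f) (hfc : HasCompactSupport f) :
    (∫ x, f x ^ 2 * log (f x ^ 2) ∂(perturb μ F))
        - (∫ x, f x ^ 2 ∂(perturb μ F)) * log (∫ x, f x ^ 2 ∂(perturb μ F))
      ≤ C * (∫ x, ‖gradient f x‖ ^ 2 ∂(perturb μ F)) + (∫ x, f x ^ 2 * F x ∂(perturb μ F))
        + C / 2 * ∫ x, f x ^ 2 * (genA V F x - 1 / 2 * ‖gradient F x‖ ^ 2) ∂(perturb μ F) := by
  have := isProbabilityMeasure_perturb hnorm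
  have hF1 : ContDiff ℝ 1 F := hF.of_le (by norm_num)
  have hcG := continuous_gradient hF1
  have hcg := continuous_gradient hf
  have hcA := continuous_genA hV hF
  have hf2 : HasCompactSupport fun x => f x ^ 2 :=
    hfc.comp_left (g := fun u : ℝ => u ^ 2) (by simp)
  have hfs : Continuous fun x => f x ^ 2 := hf.continuous.pow 2
  have hn : Continuous fun x => ‖gradient F x‖ ^ 2 := hcG.norm.pow 2
  have hng : Continuous fun x => ‖gradient f x‖ ^ 2 := hcg.norm.pow 2
  have hng' : HasCompactSupport fun x => ‖gradient f x‖ ^ 2 :=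
    (hasCompactSupport_gradient hfc).comp_left (g := fun u : En n => ‖u‖ ^ 2) (by simp)
  have hi : ∀ φ : En n → ℝ, Continuous φ → Integrable (fun x => f x ^ 2 * φ x) (perturb μ F) :=
    fun φ hφ => (hfs.mul hφ).integrable_of_hasCompactSupport hf2.mul_right
  have I1 : Integrable (fun x => f x ^ 2 * log (f x ^ 2)) (perturb μ F) :=
    (Real.continuous_mul_log.comp hfs).integrable_of_hasCompactSupport hf2.mul_right
  have I2 := hi F hF.continuous
  have I3 : Integrable (fun x => ‖gradient f x‖ ^ 2) (perturb μ F) :=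
    hng.integrable_of_hasCompactSupport hng'
  have I4 := hi (fun x => genA V F x - 1 / 2 * ‖gradient F x‖ ^ 2)
    (hcA.sub (continuous_const.mul hn))
  have I6 : Integrable (fun x => 2 * f x * ⟪gradient f x, gradient F x⟫) (perturb μ F) :=
    ((continuous_const.mul hf.continuous).mul
      (hcg.inner hcG)).integrable_of_hasCompactSupport hfc.mul_left.mul_right
  have I5 := (hi (fun x => genA V F x - ‖gradient F x‖ ^ 2) (hcA.sub hn)).fun_add I6
  have hls := h.of_contDiff_one (f := fun x => f x * exp (-F x / 2))
    (hf.mul (hF1.neg.div_const 2).exp) hfc.mul_right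
  have hsq : ∀ x, exp (-F x / 2) ^ 2 = exp (-F x) := fun x => by
    rw [← Real.exp_nat_mul]; congr 1; push_cast; ring
  have e1 : ∀ x, (f x * exp (-F x / 2)) ^ 2 = exp (-F x) * f x ^ 2 := fun x => by
    rw [mul_pow, hsq, mul_comm]
  have e2 : ∀ x, exp (-F x) * f x ^ 2 * log (exp (-F x) * f x ^ 2)
      = exp (-F x) * (f x ^ 2 * log (f x ^ 2) - f x ^ 2 * F x) := fun x => by
    rcases eq_or_ne (f x) 0 with h0 | h0
    · simp [h0]
    rw [Real.log_mul (exp_pos _).ne' (by positivity), Real.log_exp]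
    ring
  have e3 : ∀ x, ‖gradient (fun x => f x * exp (-F x / 2)) x‖ ^ 2 = exp (-F x) *
      (‖gradient f x‖ ^ 2 + 1 / 2 * (f x ^ 2 * (genA V F x - 1 / 2 * ‖gradient F x‖ ^ 2))
        - 1 / 2 * (f x ^ 2 * (genA V F x - ‖gradient F x‖ ^ 2)
          + 2 * f x * ⟪gradient f x, gradient F x⟫)) := fun x => by
    rw [gradient_mul_exp_neg_half (hf.differentiable one_ne_zero x)
      (hF1.differentiable one_ne_zero x), norm_smul, mul_pow, Real.norm_eq_abs, sq_abs, hsq,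
      norm_sub_sq_real, norm_smul, inner_smul_right, mul_pow, Real.norm_eq_abs, sq_abs]
    ring
  simp only [e1, e2, e3] at hls
  simp only [← integral_perturb hF.continuous hnorm] at hls
  rw [integral_sub I1 I2, integral_sub (I3.fun_add (I4.const_mul _)) (I5.const_mul _),
    integral_add I3 (I4.const_mul _), integral_const_mul, integral_const_mul,
    integral_perturb_sq_mul_generator_eq_zero hV hμ hF hnorm hf hfc] at hls
  linarith

/-- A defective logarithmic Sobolev inequality for the perturbed measure. -/
theorem defective_logSobolev_perturb_of_hasCompactSupport {n : ℕ} {μ : Measure (En n)}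
    [IsProbabilityMeasure μ] {V F : En n → ℝ} (hV : ContDiff ℝ 1 V)
    (hμ : μ = volume.withDensity fun x => ENNReal.ofReal (exp (-V x)))
    (hF : ContDiff ℝ 2 F) (hnorm : ∫ x, exp (-F x) ∂μ = 1) {C α β : ℝ} (hC : 0 ≤ C)
    (h : LogSobolevLE μ C) (hα : 0 < α) (hβ : 0 < β)
    (hint1 : Integrable (fun x => exp (α * F x)) (perturb μ F))
    (hint2 : Integrable (fun x => exp (β * (genA V F x - 1 / 2 * ‖gradient F x‖ ^ 2)))
      (perturb μ F))
    {f : En n → ℝ} (hf : ContDiff ℝ 1 f) (hfc : HasCompactSupport f) :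
    (1 - (C / (2 * β) + 1 / α)) * ((∫ x, f x ^ 2 * log (f x ^ 2) ∂(perturb μ F))
        - (∫ x, f x ^ 2 ∂(perturb μ F)) * log (∫ x, f x ^ 2 ∂(perturb μ F)))
      ≤ C * (∫ x, ‖gradient f x‖ ^ 2 ∂(perturb μ F))
        + (C / (2 * β) * log (∫ x, exp (β * (genA V F x - 1 / 2 * ‖gradient F x‖ ^ 2))
              ∂(perturb μ F))
            + 1 / α * log (∫ x, exp (α * F x) ∂(perturb μ F)))
          * ∫ x, f x ^ 2 ∂(perturb μ F) := by
  have := isProbabilityMeasure_perturb hnorm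
  have hf2 : HasCompactSupport fun x => f x ^ 2 :=
    hfc.comp_left (g := fun u : ℝ => u ^ 2) (by simp)
  have hfs := hf.continuous.pow 2
  have hi : ∀ φ : En n → ℝ, Continuous φ → Integrable (fun x => f x ^ 2 * φ x) (perturb μ F) :=
    fun φ hφ => (hfs.mul hφ).integrable_of_hasCompactSupport hf2.mul_right
  have hcH : Continuous fun x => genA V F x - 1 / 2 * ‖gradient F x‖ ^ 2 :=
    (continuous_genA hV hF).sub (continuous_const.mul
      ((continuous_gradient (hF.of_le (by norm_num))).norm.pow 2))
  have h1 := hfs.integrable_of_hasCompactSupport (μ := perturb μ F) hf2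
  have h2 : Integrable (fun x => f x ^ 2 * log (f x ^ 2)) (perturb μ F) :=
    (Real.continuous_mul_log.comp hfs).integrable_of_hasCompactSupport hf2.mul_right
  have hF' := integral_sq_mul_le_entropy_add h1 h2
    (hi (fun x => α * F x) (continuous_const.mul hF.continuous)) hint1
  have hH' := integral_sq_mul_le_entropy_add h1 h2
    (hi (fun x => β * (genA V F x - 1 / 2 * ‖gradient F x‖ ^ 2)) (continuous_const.mul hcH)) hint2
  have hls := h.entropy_perturb_le hV hμ hF hnorm hf hfc
  simp only [mul_left_comm _ α, mul_left_comm _ β] at hF' hH'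
  rw [integral_const_mul] at hF' hH'
  have hF'' := mul_le_mul_of_nonneg_left hF' (show 0 ≤ 1 / α by positivity)
  have hH'' := mul_le_mul_of_nonneg_left hH' (show 0 ≤ C / (2 * β) by positivity)
  rw [← mul_assoc, one_div_mul_cancel hα.ne', one_mul] at hF''
  rw [← mul_assoc, show C / (2 * β) * β = C / 2 by field_simp] at hH''
  linarith

theorem defective_logSobolev_perturb {n : ℕ} {μ : Measure (En n)}
    [IsProbabilityMeasure μ] {V F : En n → ℝ} (hV : ContDiff ℝ 1 V)
    (hμ : μ = volume.withDensity fun x => ENNReal.ofReal (exp (-V x)))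
    (hF : ContDiff ℝ 2 F) (hnorm : ∫ x, exp (-F x) ∂μ = 1) {C α β : ℝ} (hC : 0 ≤ C)
    (h : LogSobolevLE μ C) (hα : 0 < α) (hβ : 0 < β)
    (hint1 : Integrable (fun x => exp (α * F x)) (perturb μ F))
    (hint2 : Integrable (fun x => exp (β * (genA V F x - 1 / 2 * ‖gradient F x‖ ^ 2)))
      (perturb μ F))
    {f : En n → ℝ} (hf : IsTestFun f) :
    (1 - (C / (2 * β) + 1 / α)) * ((∫ x, f x ^ 2 * log (f x ^ 2) ∂(perturb μ F))
        - (∫ x, f x ^ 2 ∂(perturb μ F)) * log (∫ x, f x ^ 2 ∂(perturb μ F)))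
      ≤ C * (∫ x, ‖gradient f x‖ ^ 2 ∂(perturb μ F))
        + (C / (2 * β) * log (∫ x, exp (β * (genA V F x - 1 / 2 * ‖gradient F x‖ ^ 2))
              ∂(perturb μ F))
            + 1 / α * log (∫ x, exp (α * F x) ∂(perturb μ F)))
          * ∫ x, f x ^ 2 ∂(perturb μ F) := by
  have := isProbabilityMeasure_perturb hnorm
  obtain ⟨g, M, B, hg, hgc, hM, hB, hlim, hlim'⟩ := exists_cutoff_tendsto hf
  exact defective_logSobolev_of_tendsto hg hM hB hlim hlim' fun i =>
    defective_logSobolev_perturb_of_hasCompactSupport hV hμ hF hnorm hC h hα hβ hint1 hint2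
      (hg i) (hgc i)

/-- Rothaus' tightening: a defective logarithmic Sobolev inequality and a Poincaré inequality
imply a logarithmic Sobolev inequality. -/
theorem LogSobolevLE.of_defective {n : ℕ} {ν : Measure (En n)} [IsProbabilityMeasure ν]
    {a C K P : ℝ} (ha : 0 < a) (ha1 : a ≤ 1)
    (hdef : ∀ f : En n → ℝ, IsTestFun f →
      a * ((∫ x, f x ^ 2 * log (f x ^ 2) ∂ν) - (∫ x, f x ^ 2 ∂ν) * log (∫ x, f x ^ 2 ∂ν))
        ≤ C * (∫ x, ‖gradient f x‖ ^ 2 ∂ν) + K * ∫ x, f x ^ 2 ∂ν)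
    (hP : PoincareLE ν P) :
    LogSobolevLE ν (1 / a * (C + P * (2 + K))) := by
  have hK : 0 ≤ K := by
    have := hdef (fun _ => 1) ⟨contDiff_const, ⟨1, by simp⟩, 0, LipschitzWith.const 1⟩
    simpa [gradient] using this
  intro f hf
  obtain ⟨hfs, ⟨M, hM⟩, L, hL⟩ := id hf
  obtain ⟨c, hc⟩ : ∃ c, ∫ x, f x ∂ν = c := ⟨_, rfl⟩
  have hg : IsTestFun fun x => f x - c :=
    ⟨hfs.sub contDiff_const, ⟨M + |c|, fun x => (abs_sub _ _).trans (by gcongr; exact hM x)⟩, L,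
      by simpa using hL.sub (LipschitzWith.const c)⟩
  have hgrad : gradient (fun x => f x - c) = gradient f := by
    ext1 x
    rw [gradient, gradient, fderiv_sub_const]
  have hR := entropy_sq_le_entropy_sq_sub_integral_add hfs.continuous.measurable hM hc
  have hD := hdef _ hg
  rw [hgrad] at hD
  have hp := hP f hf
  have hi : Integrable f ν :=
    Integrable.of_bound hfs.continuous.aestronglyMeasurable M (.of_forall hM)
  have hi2 : Integrable (fun x => f x ^ 2) ν :=
    Integrable.of_bound (hfs.continuous.pow 2).aestronglyMeasurable (M ^ 2) (.of_forall fun x => by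
      simpa using sq_le_sq' (abs_le.1 (hM x)).1 (abs_le.1 (hM x)).2)
  have hvar : ∫ x, (f x - c) ^ 2 ∂ν = (∫ x, f x ^ 2 ∂ν) - (∫ x, f x ∂ν) ^ 2 := by
    have : ∀ x, (f x - c) ^ 2 = f x ^ 2 - 2 * c * f x + c ^ 2 := fun x => by ring
    simp only [this]
    rw [integral_add (hi2.sub' (hi.const_mul _)) (integrable_const _),
      integral_sub hi2 (hi.const_mul _), integral_const_mul, hc]
    simp
    ring
  rw [← hvar] at hp
  have hg0 : 0 ≤ ∫ x, (f x - c) ^ 2 ∂ν := integral_nonneg fun x => sq_nonneg _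
  have h1 := mul_le_mul_of_nonneg_left hR ha.le
  have h2 := mul_le_mul_of_nonneg_left hp (show 0 ≤ 2 + K by linarith)
  have h3 := mul_nonneg (sub_nonneg.2 ha1) hg0
  rw [mul_assoc, one_div, ← div_eq_inv_mul, le_div_iff₀ ha]
  linarith

/-- If `μ` satisfies a log-Sobolev inequality, `V` is `C¹`, `F` is `C²`,
`μ(e^{-F}) = 1`, and there exist `α > 1`, `β > 0` with `μ_F(e^{αF}) < ∞`,
`μ_F(e^{β[AF - |∇F|²/2]}) < ∞` and `δ := C_{LS}(μ)/(2β) + 1/α < 1`, then `μ_F`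
satisfies a log-Sobolev inequality with the explicit constant below. -/
theorem logSobolev_of_generator_perturbation
    {n : ℕ} (μ : Measure (En n)) [IsProbabilityMeasure μ] (V : En n → ℝ)
    (hV : ContDiff ℝ 1 V)
    (hμ : μ = volume.withDensity fun x => ENNReal.ofReal (Real.exp (-V x)))
    (F : En n → ℝ) (hF : ContDiff ℝ 2 F)
    (hnorm : ∫ x, Real.exp (-F x) ∂μ = 1)
    (Cls : ℝ) (hCls : 0 ≤ Cls) (hLS : LogSobolevLE μ Cls)
    (α β : ℝ) (hα : 1 < α) (hβ : 0 < β)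
    (hint1 : Integrable (fun x => Real.exp (α * F x)) (perturb μ F))
    (hint2 : Integrable
      (fun x => Real.exp (β * (genA V F x - (1 / 2) * ‖gradient F x‖ ^ 2)))
      (perturb μ F))
    (hδ : Cls / (2 * β) + 1 / α < 1)
    (CPF : ℝ) (hCPF : 0 ≤ CPF) (hPF : PoincareLE (perturb μ F) CPF) :
    LogSobolevLE (perturb μ F)
      (1 / (1 - (Cls / (2 * β) + 1 / α)) *
        (Cls + CPF * (2 +
          Cls / (2 * β) *
            Real.log (∫ x, Real.exp (β * (genA V F x - (1 / 2) * ‖gradient F x‖ ^ 2))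
              ∂(perturb μ F)) +
          (1 / α) * Real.log (∫ x, Real.exp (α * F x) ∂(perturb μ F))))) := by
  have := isProbabilityMeasure_perturb hnorm
  rw [add_assoc]
  refine LogSobolevLE.of_defective (sub_pos.2 hδ) ?_ (fun f hf => ?_) hPF
  · have : 0 ≤ Cls / (2 * β) + 1 / α := by positivity
    linarith
  · exact defective_logSobolev_perturb hV hμ hF hnorm hCls hLS (by positivity) hβ hint1 hint2 hf
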